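/- Let f be a multicritical circle map with irrational rotation number and fixed critical point c₀, and for each n set T_n = I_{n+1} ∪ I_n ∪ f^{q_n}(I_n). Then for every n, the family {T_n, f(T_n), …, f^{q_{n+1}−1}(T_n)} has intersection multiplicity at most 3: every point x ∈ S¹ belongs to at most 3 of the intervals f^i(T_n), 0 ≤ i ≤ q_{n+1}−1. -/

import Mathlib

open Set Filter Topology
open scoped ENNReal

noncomputable section

namespace MCircle

/-- A lift of an orientation-preserving `C³` circle homeomorphism of `S¹ = ℝ/ℤ`:
a `C³`, strictly increasing map commuting with the unit translation. -/
structure IsCircleMapLift (f : ℝ → ℝ) : Prop where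
  smooth : ContDiff ℝ 3 f
  mono : StrictMono f
  periodic : ∀ x : ℝ, f (x + 1) = f x + 1

/-- `c` is a non-flat (power-law) critical point of `f` of criticality `d > 1`:
near `c` we have `f x = f c + φ x * |φ x| ^ (d - 1)` for a `C³` diffeomorphism `φ`
of a neighbourhood `W` of `c` with `φ c = 0`. -/
def IsNonFlatCritPt (f : ℝ → ℝ) (c d : ℝ) : Prop :=
  1 < d ∧ ∃ (W : Set ℝ) (φ : ℝ → ℝ), IsOpen W ∧ c ∈ W ∧
    ContDiffOn ℝ 3 φ W ∧ φ c = 0 ∧ (∀ x ∈ W, deriv φ x ≠ 0) ∧ InjOn φ W ∧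
    ∀ x ∈ W, f x = f c + φ x * |φ x| ^ (d - 1)

/-- `f` is (a lift of) a multicritical circle map: the set of critical points of the
induced circle map, represented in `[0,1)`, is the nonempty finite set `C`, and each
critical point `c ∈ C` is non-flat of criticality `dc c`. -/
def IsMulticriticalLift (f : ℝ → ℝ) (C : Finset ℝ) (dc : ℝ → ℝ) : Prop :=
  IsCircleMapLift f ∧ C.Nonempty ∧ (↑C : Set ℝ) ⊆ Ico (0 : ℝ) 1 ∧
    (∀ x : ℝ, deriv f x = 0 ↔ ∃ c ∈ C, ∃ k : ℤ, x = c + (k : ℝ)) ∧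
    ∀ c ∈ C, IsNonFlatCritPt f c (dc c)

/-- The lift `f` has (translation) rotation number `ρ`. -/
def HasRotNumber (f : ℝ → ℝ) (ρ : ℝ) : Prop :=
  Tendsto (fun n : ℕ => f^[n] 0 / (n : ℝ)) atTop (𝓝 ρ)

/-- `f` is (a lift of) a multicritical circle map with critical set `C` (criticalities
`dc`) and irrational rotation number `ρ`, the lift being normalized so that `ρ ∈ (0,1)`. -/
def GoodMap (f : ℝ → ℝ) (C : Finset ℝ) (dc : ℝ → ℝ) (ρ : ℝ) : Prop :=
  IsMulticriticalLift f C dc ∧ HasRotNumber f ρ ∧ Irrational ρ ∧ ρ ∈ Ioo (0 : ℝ) 1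

/-- The Gauss map. -/
def gaussMap (x : ℝ) : ℝ := Int.fract x⁻¹

/-- The partial quotients `aₙ` of the continued fraction expansion
`ρ = [a₀, a₁, …] = 1/(a₀ + 1/(a₁ + ⋯))`. -/
def cfA (ρ : ℝ) (n : ℕ) : ℕ := ⌊(gaussMap^[n] (Int.fract ρ))⁻¹⌋₊

/-- The denominators `qₙ` of the convergents of `ρ` (the return times):
`q₀ = 1`, `q₁ = a₀`, `q_{n+2} = a_{n+1} q_{n+1} + qₙ`. -/
def qden (ρ : ℝ) : ℕ → ℕ
  | 0 => 1
  | 1 => cfA ρ 0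
  | n + 2 => cfA ρ (n + 1) * qden ρ (n + 1) + qden ρ n

/-- The numerators `pₙ` of the convergents of `ρ`:
`p₀ = 0`, `p₁ = 1`, `p_{n+2} = a_{n+1} p_{n+1} + pₙ`. -/
def pnum (ρ : ℝ) : ℕ → ℕ
  | 0 => 0
  | 1 => 1
  | n + 2 => cfA ρ (n + 1) * pnum ρ (n + 1) + pnum ρ n

/-- The lift representative of the `n`-th closest return `f^{qₙ}(x)`,
normalized (by the integer `pₙ`) to lie at distance less than one from `x`. -/
def retPt (f : ℝ → ℝ) (ρ x : ℝ) (n : ℕ) : ℝ := f^[qden ρ n] x - (pnum ρ n : ℝ)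

/-- The arc `Iₙ(x)`, with endpoints `x` and `f^{qₙ}(x)` and containing `f^{q_{n+2}}(x)`,
realized as an interval in the lift. -/
def arcI (f : ℝ → ℝ) (ρ x : ℝ) (n : ℕ) : Set ℝ := uIcc x (retPt f ρ x n)

/-- The length `|Iₙ(x)|`. -/
def arcLen (f : ℝ → ℝ) (ρ x : ℝ) (n : ℕ) : ℝ := |retPt f ρ x n - x|

/-- The length `|f^j(Iₙ(x))|`. -/
def arcImgLen (f : ℝ → ℝ) (ρ x : ℝ) (n j : ℕ) : ℝ :=
  |f^[j] (retPt f ρ x n) - f^[j] x|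

/-- Indices for the atoms of the `n`-th dynamical partition
`𝒫ₙ(x) = {fⁱ(Iₙ(x)) : 0 ≤ i ≤ q_{n+1}-1} ∪ {f^j(I_{n+1}(x)) : 0 ≤ j ≤ qₙ-1}`. -/
abbrev AtomIdx (ρ : ℝ) (n : ℕ) : Type :=
  {i : ℕ // i < qden ρ (n + 1)} ⊕ {j : ℕ // j < qden ρ n}

/-- Left endpoint (in the lift) of an atom of `𝒫ₙ(x)`. -/
def atomL (f : ℝ → ℝ) (ρ x : ℝ) (n : ℕ) : AtomIdx ρ n → ℝ
  | Sum.inl i => min (f^[i.1] x) (f^[i.1] (retPt f ρ x n))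
  | Sum.inr j => min (f^[j.1] x) (f^[j.1] (retPt f ρ x (n + 1)))

/-- Right endpoint (in the lift) of an atom of `𝒫ₙ(x)`. -/
def atomR (f : ℝ → ℝ) (ρ x : ℝ) (n : ℕ) : AtomIdx ρ n → ℝ
  | Sum.inl i => max (f^[i.1] x) (f^[i.1] (retPt f ρ x n))
  | Sum.inr j => max (f^[j.1] x) (f^[j.1] (retPt f ρ x (n + 1)))

/-- Length of an atom of `𝒫ₙ(x)`. -/
def atomLen (f : ℝ → ℝ) (ρ x : ℝ) (n : ℕ) (A : AtomIdx ρ n) : ℝ :=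
  atomR f ρ x n A - atomL f ρ x n A

/-- Two lift points represent the same point of the circle `ℝ/ℤ`. -/
def SameCirclePt (a b : ℝ) : Prop := ∃ m : ℤ, a = b + (m : ℝ)

/-- Two atoms of `𝒫ₙ(x)` are adjacent: they are distinct and share an endpoint
on the circle. -/
def AdjacentAtoms (f : ℝ → ℝ) (ρ x : ℝ) (n : ℕ) (A B : AtomIdx ρ n) : Prop :=
  A ≠ B ∧ ∃ p ∈ ({atomL f ρ x n A, atomR f ρ x n A} : Set ℝ),
    ∃ q ∈ ({atomL f ρ x n B, atomR f ρ x n B} : Set ℝ), SameCirclePt p q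

/-- `A` is the left neighbour of `Δ` in `𝒫ₙ(x)`. -/
def IsLeftNbr (f : ℝ → ℝ) (ρ x : ℝ) (n : ℕ) (A Δ : AtomIdx ρ n) : Prop :=
  A ≠ Δ ∧ SameCirclePt (atomR f ρ x n A) (atomL f ρ x n Δ)

/-- `B` is the right neighbour of `Δ` in `𝒫ₙ(x)`. -/
def IsRightNbr (f : ℝ → ℝ) (ρ x : ℝ) (n : ℕ) (B Δ : AtomIdx ρ n) : Prop :=
  B ≠ Δ ∧ SameCirclePt (atomL f ρ x n B) (atomR f ρ x n Δ)

/-- The arc `f^j(Δ)` is contained (as a circle arc) in some element of `𝒫ₙ(x)`. -/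
def ImgInAtom (f : ℝ → ℝ) (ρ x : ℝ) (n j : ℕ) (Δ : AtomIdx ρ n) : Prop :=
  ∃ E : AtomIdx ρ n, ∃ m : ℤ,
    atomL f ρ x n E + (m : ℝ) ≤ f^[j] (atomL f ρ x n Δ) ∧
    f^[j] (atomR f ρ x n Δ) ≤ atomR f ρ x n E + (m : ℝ)

/-- An atom of `𝒫ₙ(x)` as a subset of the circle `ℝ/ℤ`. -/
def atomSetC (f : ℝ → ℝ) (ρ x : ℝ) (n : ℕ) (A : AtomIdx ρ n) : Set (AddCircle (1 : ℝ)) :=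
  (fun y : ℝ => (y : AddCircle (1 : ℝ))) '' Icc (atomL f ρ x n A) (atomR f ρ x n A)

/-- The interval `Tₙ = I_{n+1} ∪ Iₙ ∪ f^{qₙ}(Iₙ)`, realized in the lift. -/
def Tset (f : ℝ → ℝ) (ρ x : ℝ) (n : ℕ) : Set ℝ :=
  arcI f ρ x (n + 1) ∪ arcI f ρ x n ∪
    (fun z => f^[qden ρ n] z - (pnum ρ n : ℝ)) '' arcI f ρ x n

/-- `j` is a critical time: `f^j(Tₙ)` contains a critical point of `f` (mod 1). -/
def IsCritTime (f : ℝ → ℝ) (ρ x : ℝ) (C : Finset ℝ) (n j : ℕ) : Prop :=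
  ∃ c ∈ C, ∃ m : ℤ, c + (m : ℝ) ∈ f^[j] '' Tset f ρ x n

/-- The cross-ratio `[M,T] = |L||R|/(|L∪M||M∪R|)` of the configuration
`M = [b,c] ⋐ T = [a,d]` (so `L = [a,b]`, `R = [c,d]`). -/
def crossRatio (a b c d : ℝ) : ℝ := ((b - a) * (d - c)) / ((c - a) * (d - b))

/-- The cross-ratio distortion `CrD(g; M, T)` of `g` on the configuration
`M = [b,c] ⋐ T = [a,d]`. -/
def crD (g : ℝ → ℝ) (a b c d : ℝ) : ℝ :=
  crossRatio (g a) (g b) (g c) (g d) / crossRatio a b c d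

/-- The Schwarzian derivative `Sg = g'''/g' - (3/2)(g''/g')²`. -/
def schwarzian (g : ℝ → ℝ) (x : ℝ) : ℝ :=
  iteratedDeriv 3 g x / deriv g x - (3 / 2) * (iteratedDeriv 2 g x / deriv g x) ^ 2

/-- `g` is a diffeomorphism on `S` with distortion bounded by `K`. -/
def DiffeoWithDistortionLE (g : ℝ → ℝ) (S : Set ℝ) (K : ℝ) : Prop :=
  ContDiffOn ℝ 1 g S ∧ InjOn g S ∧ (∀ x ∈ S, deriv g x ≠ 0) ∧
    ∀ x ∈ S, ∀ y ∈ S, |deriv g x| ≤ K * |deriv g y|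

/-- `g` is a diffeomorphism on `S` with negative Schwarzian derivative. -/
def NegSchwarzDiffeoOn (g : ℝ → ℝ) (S : Set ℝ) : Prop :=
  ContDiffOn ℝ 3 g S ∧ InjOn g S ∧ ∀ x ∈ S, deriv g x ≠ 0 ∧ schwarzian g x < 0

/-- The local quasi-symmetric distortion
`σ_h(x) = lim_{δ→0} limsup_{|t|≤δ} |h(x+t)-h(x)|/|h(x)-h(x-t)|` of a circle
homeomorphism lift `h`, with values in `[0,∞]`. -/
def qsDistortion (h : ℝ → ℝ) (x : ℝ) : ℝ≥0∞ :=
  Filter.limsup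
    (fun t : ℝ => ENNReal.ofReal (|h (x + t) - h x| / |h x - h (x - t)|))
    (𝓝[≠] (0 : ℝ))

end MCircle

open MCircle

namespace MCircle

section ContinuedFraction

variable {ρ : ℝ}

lemma irrational_gaussMap_iterate (hρ : Irrational ρ) (n : ℕ) :
    Irrational (gaussMap^[n] (Int.fract ρ)) := by
  induction n with
  | zero => exact hρ.sub_intCast _
  | succ n ih =>
    rw [Function.iterate_succ_apply']
    exact ih.inv.sub_intCast _

lemma gaussMap_iterate_mem_Ioo (hρ : Irrational ρ) (n : ℕ) :
    gaussMap^[n] (Int.fract ρ) ∈ Ioo (0 : ℝ) 1 := by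
  have key : gaussMap^[n] (Int.fract ρ) ∈ Ico (0 : ℝ) 1 := by
    cases n with
    | zero => exact ⟨Int.fract_nonneg _, Int.fract_lt_one _⟩
    | succ n =>
      rw [Function.iterate_succ_apply']
      exact ⟨Int.fract_nonneg _, Int.fract_lt_one _⟩
  exact ⟨lt_of_le_of_ne key.1 (irrational_gaussMap_iterate hρ n).ne_zero.symm, key.2⟩

lemma cfA_add_gaussMap_iterate (hρ : Irrational ρ) (n : ℕ) :
    (cfA ρ n : ℝ) + gaussMap^[n + 1] (Int.fract ρ) = (gaussMap^[n] (Int.fract ρ))⁻¹ := by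
  rw [Function.iterate_succ_apply', cfA, gaussMap,
    natCast_floor_eq_intCast_floor (inv_nonneg.2 (gaussMap_iterate_mem_Ioo hρ n).1.le)]
  exact Int.floor_add_fract _

/-- The signed error `qₙ ρ - pₙ` of the `n`-th convergent. -/
def convErr (ρ : ℝ) (n : ℕ) : ℝ := qden ρ n * ρ - pnum ρ n

lemma convErr_succ (hρ : Irrational ρ) (h01 : ρ ∈ Ioo (0 : ℝ) 1) (n : ℕ) :
    convErr ρ (n + 1) = -(gaussMap^[n + 1] (Int.fract ρ) * convErr ρ n) := by
  induction n with
  | zero =>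
    have h := cfA_add_gaussMap_iterate hρ 0
    have hfr : Int.fract ρ = ρ := Int.fract_eq_self.2 ⟨h01.1.le, h01.2⟩
    simp only [Function.iterate_zero, id, hfr] at h
    have hne : ρ ≠ 0 := h01.1.ne'
    rw [← eq_sub_iff_add_eq'] at h
    simp only [zero_add] at h ⊢
    rw [hfr, h]
    simp only [convErr, qden, pnum]
    field_simp
    push_cast
    ring
  | succ n ih =>
    have h := cfA_add_gaussMap_iterate hρ (n + 1)
    have hne := (gaussMap_iterate_mem_Ioo hρ (n + 1)).1.ne'
    have hrec : convErr ρ (n + 2) = cfA ρ (n + 1) * convErr ρ (n + 1) + convErr ρ n := by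
      simp only [convErr, qden, pnum]
      push_cast
      ring
    rw [← eq_sub_iff_add_eq'] at h
    rw [hrec, h, ih]
    field_simp
    ring

lemma convErr_ne_zero (hρ : Irrational ρ) (h01 : ρ ∈ Ioo (0 : ℝ) 1) (n : ℕ) :
    convErr ρ n ≠ 0 := by
  induction n with
  | zero => simpa [convErr, qden, pnum] using h01.1.ne'
  | succ n ih =>
    rw [convErr_succ hρ h01]
    exact neg_ne_zero.2 (mul_ne_zero (gaussMap_iterate_mem_Ioo hρ _).1.ne' ih)

lemma convErr_mul_succ_neg (hρ : Irrational ρ) (h01 : ρ ∈ Ioo (0 : ℝ) 1) (n : ℕ) :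
    convErr ρ n * convErr ρ (n + 1) < 0 := by
  rw [convErr_succ hρ h01]
  have := mul_pos (gaussMap_iterate_mem_Ioo hρ (n + 1)).1
    (mul_self_pos.2 (convErr_ne_zero hρ h01 n))
  linarith

lemma abs_convErr_succ_lt (hρ : Irrational ρ) (h01 : ρ ∈ Ioo (0 : ℝ) 1) (n : ℕ) :
    |convErr ρ (n + 1)| < |convErr ρ n| := by
  have hx := gaussMap_iterate_mem_Ioo hρ (n + 1)
  rw [convErr_succ hρ h01, abs_neg, abs_mul, abs_of_pos hx.1]
  exact mul_lt_of_lt_one_left (abs_pos.2 (convErr_ne_zero hρ h01 n)) hx.2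

lemma qden_mul_pnum_sub (ρ : ℝ) (n : ℕ) :
    (qden ρ n : ℤ) * pnum ρ (n + 1) - qden ρ (n + 1) * pnum ρ n = (-1) ^ n := by
  induction n with
  | zero => simp [qden, pnum]
  | succ n ih =>
    simp only [qden, pnum]
    push_cast
    rw [pow_succ, ← ih]
    ring

/-- The best approximation property of the convergents. -/
lemma abs_convErr_le (hρ : Irrational ρ) (h01 : ρ ∈ Ioo (0 : ℝ) 1) (n : ℕ) {k : ℤ}
    (hk : 0 < k) (hkq : k < qden ρ (n + 1)) (m : ℤ) :
    |convErr ρ n| ≤ |k * ρ - m| := by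
  have hdet := qden_mul_pnum_sub ρ n
  have hsq : ((-1 : ℤ) ^ n) * (-1) ^ n = 1 := by rw [← mul_pow]; simp
  set e : ℤ := (-1) ^ n
  obtain ⟨u, hu⟩ : ∃ u : ℤ, u = e * (k * pnum ρ (n + 1) - m * qden ρ (n + 1)) := ⟨_, rfl⟩
  obtain ⟨v, hv⟩ : ∃ v : ℤ, v = e * (m * qden ρ n - k * pnum ρ n) := ⟨_, rfl⟩
  have hkuv : k = u * qden ρ n + v * qden ρ (n + 1) := by
    rw [hu, hv]
    linear_combination (-k) * hsq - e * k * hdet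
  have hmuv : m = u * pnum ρ n + v * pnum ρ (n + 1) := by
    rw [hu, hv]
    linear_combination (-m) * hsq - e * m * hdet
  have herr : (k : ℝ) * ρ - m = u * convErr ρ n + v * convErr ρ (n + 1) := by
    rw [hkuv, hmuv]
    simp only [convErr]
    push_cast
    ring
  have hq : (0 : ℤ) ≤ qden ρ n := Int.natCast_nonneg _
  have hq' : (0 : ℤ) < qden ρ (n + 1) := hk.trans hkq
  have hu0 : u ≠ 0 := by
    rintro h
    rw [h, zero_mul, zero_add] at hkuv
    rcases le_or_gt v 0 with hv0 | hv0 <;> nlinarith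
  have huv : u * v ≤ 0 := by
    by_contra! h
    rcases pos_and_pos_or_neg_and_neg_of_mul_pos h with ⟨h1, h2⟩ | ⟨h1, h2⟩ <;> nlinarith
  have hu1 : (1 : ℝ) ≤ |(u : ℝ)| := by exact_mod_cast Int.one_le_abs hu0
  have hcross : 0 ≤ (u * convErr ρ n) * (v * convErr ρ (n + 1)) := by
    have h1 : (u : ℝ) * v ≤ 0 := by exact_mod_cast huv
    have := mul_nonneg_of_nonpos_of_nonpos h1 (convErr_mul_succ_neg hρ h01 n).le
    linarith
  calc |convErr ρ n| ≤ |(u : ℝ)| * |convErr ρ n| := le_mul_of_one_le_left (abs_nonneg _) hu1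
    _ = |u * convErr ρ n| := (abs_mul _ _).symm
    _ ≤ |u * convErr ρ n + v * convErr ρ (n + 1)| := by
      rw [← sq_le_sq]
      nlinarith [sq_nonneg (v * convErr ρ (n + 1))]
    _ = |k * ρ - m| := by rw [herr]

lemma abs_convErr_le_abs_sub (hρ : Irrational ρ) (h01 : ρ ∈ Ioo (0 : ℝ) 1) (n : ℕ) {i j : ℕ}
    (hi : i < qden ρ (n + 1)) (hj : j < qden ρ (n + 1)) (hij : i ≠ j) (a b : ℤ) :
    |convErr ρ n| ≤ |(i * ρ - a) - (j * ρ - b)| := by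
  wlog h : j < i generalizing i j a b
  · rw [abs_sub_comm]
    exact this hj hi hij.symm b a (by omega)
  have := abs_convErr_le hρ h01 n (k := i - j) (by omega) (by omega) (a - b)
  convert this using 2
  push_cast
  ring

end ContinuedFraction

section Orbits

variable {f : ℝ → ℝ} {ρ : ℝ}

/-- The bundled degree one lift. -/
def IsCircleMapLift.toDeg1Lift (hf : IsCircleMapLift f) : CircleDeg1Lift where
  toFun := f
  monotone' := hf.mono.monotone
  map_add_one' := hf.periodic

lemma IsCircleMapLift.iterate_add_int (hf : IsCircleMapLift f) (n : ℕ) (x : ℝ) (m : ℤ) :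
    f^[n] (x + m) = f^[n] x + m := by
  have := (hf.toDeg1Lift ^ n).map_add_int x m
  rwa [CircleDeg1Lift.coe_pow] at this

lemma HasRotNumber.translationNumber_eq (hf : IsCircleMapLift f) (h : HasRotNumber f ρ) :
    CircleDeg1Lift.translationNumber hf.toDeg1Lift = ρ := by
  have h1 := hf.toDeg1Lift.tendsto_translationNumber 0
  simp only [sub_zero, CircleDeg1Lift.coe_pow] at h1
  exact tendsto_nhds_unique h1 h

lemma HasRotNumber.le_of_add_int_le (hf : IsCircleMapLift f) (h : HasRotNumber f ρ) {x : ℝ}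
    {d : ℕ} {m : ℤ} (hx : x + m ≤ f^[d] x) : m ≤ d * ρ := by
  rw [← h.translationNumber_eq hf, ← CircleDeg1Lift.translationNumber_pow]
  refine ge_of_tendsto ((hf.toDeg1Lift ^ d).tendsto_translationNumber x) ?_
  filter_upwards [eventually_gt_atTop 0] with n hn
  have hx' : x + m ≤ (hf.toDeg1Lift ^ d) x := by rwa [CircleDeg1Lift.coe_pow]
  have := CircleDeg1Lift.le_iterate_of_add_int_le_map _ hx' n
  rw [CircleDeg1Lift.coe_pow, le_div_iff₀ (by exact_mod_cast hn)]
  linarith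

lemma HasRotNumber.le_of_le_add_int (hf : IsCircleMapLift f) (h : HasRotNumber f ρ) {x : ℝ}
    {d : ℕ} {m : ℤ} (hx : f^[d] x ≤ x + m) : d * ρ ≤ m := by
  rw [← h.translationNumber_eq hf, ← CircleDeg1Lift.translationNumber_pow]
  refine le_of_tendsto ((hf.toDeg1Lift ^ d).tendsto_translationNumber x) ?_
  filter_upwards [eventually_gt_atTop 0] with n hn
  have hx' : (hf.toDeg1Lift ^ d) x ≤ x + m := by rwa [CircleDeg1Lift.coe_pow]
  have := CircleDeg1Lift.iterate_le_of_map_le_add_int _ hx' n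
  rw [CircleDeg1Lift.coe_pow, div_le_iff₀ (by exact_mod_cast hn)]
  linarith

/-- An orbit of `f` is ordered on the line as an orbit of the translation by `ρ`. -/
lemma HasRotNumber.add_le_add_of_iterate_le (hf : IsCircleMapLift f) (h : HasRotNumber f ρ)
    {x : ℝ} {a b : ℕ} {k l : ℤ} (hx : f^[a] x + k ≤ f^[b] x + l) :
    a * ρ + k ≤ b * ρ + l := by
  rcases le_total a b with hab | hab
  · obtain ⟨d, rfl⟩ := Nat.exists_eq_add_of_le hab
    rw [Function.iterate_add_apply, ← hf.iterate_add_int, ← hf.iterate_add_int,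
      (hf.mono.iterate a).le_iff_le] at hx
    have := h.le_of_add_int_le hf (x := x) (d := d) (m := k - l) (by push_cast; linarith)
    push_cast at this ⊢
    linarith
  · obtain ⟨d, rfl⟩ := Nat.exists_eq_add_of_le hab
    rw [Function.iterate_add_apply, ← hf.iterate_add_int b (f^[d] x), ← hf.iterate_add_int b x,
      (hf.mono.iterate b).le_iff_le] at hx
    have := h.le_of_le_add_int hf (x := x) (d := d) (m := l - k) (by push_cast; linarith)
    push_cast at this ⊢
    linarith

lemma lt_retPt (hf : IsCircleMapLift f) (h : HasRotNumber f ρ) (x : ℝ) {n : ℕ}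
    (hn : 0 < convErr ρ n) : x < retPt f ρ x n := by
  by_contra! hle
  have := h.le_of_le_add_int hf (x := x) (d := qden ρ n) (m := pnum ρ n)
    (by rw [retPt] at hle; push_cast; linarith)
  rw [convErr] at hn
  push_cast at this
  linarith

lemma retPt_lt (hf : IsCircleMapLift f) (h : HasRotNumber f ρ) (x : ℝ) {n : ℕ}
    (hn : convErr ρ n < 0) : retPt f ρ x n < x := by
  by_contra! hle
  have := h.le_of_add_int_le hf (x := x) (d := qden ρ n) (m := pnum ρ n)
    (by rw [retPt] at hle; push_cast; linarith)
  rw [convErr] at hn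
  push_cast at this
  linarith

lemma IsCircleMapLift.monotone_retPt (hf : IsCircleMapLift f) (ρ : ℝ) (n : ℕ) :
    Monotone fun x => retPt f ρ x n := fun _ _ hxy =>
  sub_le_sub_right ((hf.mono.iterate _).monotone hxy) _

lemma Tset_subset_Icc_of_pos (hf : IsCircleMapLift f) (h : HasRotNumber f ρ) (x : ℝ) {n : ℕ}
    (hn : 0 < convErr ρ n) (hn' : convErr ρ (n + 1) < 0) :
    Tset f ρ x n ⊆ Icc (retPt f ρ x (n + 1)) (retPt f ρ (retPt f ρ x n) n) := by
  have h1 := lt_retPt hf h x hn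
  have h2 := lt_retPt hf h (retPt f ρ x n) hn
  have h3 := retPt_lt hf h x hn'
  rintro z ((hz | hz) | ⟨w, hw, rfl⟩)
  · rw [arcI, uIcc_of_ge h3.le] at hz
    exact ⟨hz.1, by linarith [hz.2]⟩
  · rw [arcI, uIcc_of_le h1.le] at hz
    exact ⟨by linarith [hz.1], by linarith [hz.2]⟩
  · rw [arcI, uIcc_of_le h1.le] at hw
    have h4 := hf.monotone_retPt ρ n hw.1
    exact ⟨by simp only [retPt] at *; linarith, hf.monotone_retPt ρ n hw.2⟩

lemma Tset_subset_Icc_of_neg (hf : IsCircleMapLift f) (h : HasRotNumber f ρ) (x : ℝ) {n : ℕ}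
    (hn : convErr ρ n < 0) (hn' : 0 < convErr ρ (n + 1)) :
    Tset f ρ x n ⊆ Icc (retPt f ρ (retPt f ρ x n) n) (retPt f ρ x (n + 1)) := by
  have h1 := retPt_lt hf h x hn
  have h2 := retPt_lt hf h (retPt f ρ x n) hn
  have h3 := lt_retPt hf h x hn'
  rintro z ((hz | hz) | ⟨w, hw, rfl⟩)
  · rw [arcI, uIcc_of_le h3.le] at hz
    exact ⟨by linarith [hz.1], hz.2⟩
  · rw [arcI, uIcc_of_ge h1.le] at hz
    exact ⟨by linarith [hz.1], by linarith [hz.2]⟩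
  · rw [arcI, uIcc_of_ge h1.le] at hw
    have h4 := hf.monotone_retPt ρ n hw.2
    exact ⟨hf.monotone_retPt ρ n hw.1, by simp only [retPt] at *; linarith⟩

lemma IsCircleMapLift.iterate_retPt (hf : IsCircleMapLift f) (ρ x : ℝ) (n i : ℕ) :
    f^[i] (retPt f ρ x n) = f^[i + qden ρ n] x + (-(pnum ρ n : ℤ) : ℤ) := by
  rw [Function.iterate_add_apply, ← hf.iterate_add_int, retPt]
  push_cast
  rw [sub_eq_add_neg]

lemma IsCircleMapLift.iterate_retPt_retPt (hf : IsCircleMapLift f) (ρ x : ℝ) (n i : ℕ) :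
    f^[i] (retPt f ρ (retPt f ρ x n) n)
      = f^[i + qden ρ n + qden ρ n] x + (-(2 * pnum ρ n : ℤ) : ℤ) := by
  rw [hf.iterate_retPt, hf.iterate_retPt]
  push_cast
  ring

/-- Iterates of `Tₙ` that meet on the circle start at points whose rotation coordinates are
close. -/
lemma sub_le_of_mem_image_Tset (hf : IsCircleMapLift f) (h : HasRotNumber f ρ)
    (hρ : Irrational ρ) (h01 : ρ ∈ Ioo (0 : ℝ) 1) {x y : ℝ} {n i j : ℕ} {a b : ℤ}
    (hi : y + a ∈ f^[i] '' Tset f ρ x n) (hj : y + b ∈ f^[j] '' Tset f ρ x n) :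
    (i * ρ - a) - (j * ρ - b) ≤ 2 * |convErr ρ n| + |convErr ρ (n + 1)| := by
  obtain ⟨z, hz, hza⟩ := hi
  obtain ⟨w, hw, hwb⟩ := hj
  have hsign := convErr_mul_succ_neg hρ h01 n
  rcases (convErr_ne_zero hρ h01 n).lt_or_gt with hn | hn
  · have hn' : 0 < convErr ρ (n + 1) := pos_of_mul_neg_right hsign hn.le
    have h1 := (hf.mono.iterate i).monotone (Tset_subset_Icc_of_neg hf h x hn hn' hz).1
    have h2 := (hf.mono.iterate j).monotone (Tset_subset_Icc_of_neg hf h x hn hn' hw).2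
    rw [hf.iterate_retPt_retPt, hza] at h1
    rw [hf.iterate_retPt, hwb] at h2
    have := h.add_le_add_of_iterate_le hf (x := x) (a := i + qden ρ n + qden ρ n)
      (b := j + qden ρ (n + 1)) (k := -(2 * pnum ρ n : ℤ) - a) (l := -(pnum ρ (n + 1) : ℤ) - b)
      (by push_cast at h1 h2 ⊢; linarith)
    rw [abs_of_neg hn, abs_of_pos hn', convErr, convErr]
    push_cast at this
    linarith
  · have hn' : convErr ρ (n + 1) < 0 := neg_of_mul_neg_right hsign hn.le
    have h1 := (hf.mono.iterate i).monotone (Tset_subset_Icc_of_pos hf h x hn hn' hz).1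
    have h2 := (hf.mono.iterate j).monotone (Tset_subset_Icc_of_pos hf h x hn hn' hw).2
    rw [hf.iterate_retPt, hza] at h1
    rw [hf.iterate_retPt_retPt, hwb] at h2
    have := h.add_le_add_of_iterate_le hf (x := x) (a := i + qden ρ (n + 1))
      (b := j + qden ρ n + qden ρ n) (k := -(pnum ρ (n + 1) : ℤ) - a)
      (l := -(2 * pnum ρ n : ℤ) - b) (by push_cast at h1 h2 ⊢; linarith)
    rw [abs_of_pos hn, abs_of_neg hn', convErr, convErr]
    push_cast at this
    linarith

end Orbits

/-- A `δ`-separated family of reals of diameter less than `N δ` has at most `N` members. -/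
lemma card_le_of_separated {ι : Type*} (s : Finset ι) (x : ι → ℝ) {δ : ℝ} (hδ : 0 < δ) (N : ℕ)
    (hsep : ∀ i ∈ s, ∀ j ∈ s, i ≠ j → δ ≤ |x i - x j|)
    (hdiam : ∀ i ∈ s, ∀ j ∈ s, x i - x j < N * δ) : s.card ≤ N := by
  rcases s.eq_empty_or_nonempty with rfl | hs
  · simp
  obtain ⟨i₀, hi₀, hmin⟩ := s.exists_min_image x hs
  have hcard : s.card ≤ (Finset.Ico (0 : ℤ) N).card := by
    refine Finset.card_le_card_of_injOn (fun i => ⌊(x i - x i₀) / δ⌋) (fun i hi => ?_)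
      fun i hi j hj hij => ?_
    · rw [Finset.mem_coe, Finset.mem_Ico, Int.floor_lt]
      refine ⟨Int.floor_nonneg.2 (div_nonneg (sub_nonneg.2 (hmin i hi)) hδ.le), ?_⟩
      rw [div_lt_iff₀ hδ]
      exact_mod_cast hdiam i hi i₀ hi₀
    · by_contra hne
      have h1 := Int.abs_sub_lt_one_of_floor_eq_floor hij
      rw [← sub_div, sub_sub_sub_cancel_right, abs_div, abs_of_pos hδ, div_lt_one hδ] at h1
      exact absurd (hsep i hi j hj hne) h1.not_ge
  simpa using hcard

end MCircle

/-- **Multiplicity of intersection of the `Tₙ` orbit is at most 3** (Fact 3.3).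
For a multicritical circle map `f` with irrational rotation number, fixed critical
point `c₀`, and `Tₙ = I_{n+1} ∪ Iₙ ∪ f^{qₙ}(Iₙ)`, every point of the circle belongs
to at most `3` of the intervals `fⁱ(Tₙ)`, `0 ≤ i ≤ q_{n+1} - 1`. -/
theorem T_multiplicity_three (f : ℝ → ℝ) (C : Finset ℝ) (dc : ℝ → ℝ) (ρ c₀ : ℝ)
    (hf : GoodMap f C dc ρ) (hc₀ : c₀ ∈ C) :
    ∀ n : ℕ, ∀ y : ℝ,
      Set.ncard
        {i : ℕ | i < qden ρ (n + 1) ∧ ∃ m : ℤ, y + (m : ℝ) ∈ f^[i] '' Tset f ρ c₀ n}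
        ≤ 3 := by
  obtain ⟨⟨hlift, -⟩, hrot, hρ, h01⟩ := hf
  intro n y
  set S := {i : ℕ | i < qden ρ (n + 1) ∧ ∃ m : ℤ, y + (m : ℝ) ∈ f^[i] '' Tset f ρ c₀ n}
  have hfin : S.Finite := (finite_lt_nat (qden ρ (n + 1))).subset fun i hi => hi.1
  have hex : ∀ i, ∃ m : ℤ, i ∈ S → y + (m : ℝ) ∈ f^[i] '' Tset f ρ c₀ n := fun i => by
    by_cases hi : i ∈ S
    · exact hi.2.imp fun m hm _ => hm
    · exact ⟨0, fun h => absurd h hi⟩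
  choose m hm using hex
  rw [ncard_eq_toFinset_card S hfin]
  refine card_le_of_separated hfin.toFinset (fun i => i * ρ - m i)
    (abs_pos.2 (convErr_ne_zero hρ h01 n)) 3 (fun i hi j hj hij => ?_) fun i hi j hj => ?_
  · rw [Finite.mem_toFinset] at hi hj
    exact abs_convErr_le_abs_sub hρ h01 n hi.1 hj.1 hij _ _
  · rw [Finite.mem_toFinset] at hi hj
    have h1 := sub_le_of_mem_image_Tset hlift hrot hρ h01 (hm i hi) (hm j hj)
    have h2 := abs_convErr_succ_lt hρ h01 n
    push_cast
    linarith
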